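/- Let p ≥ 1 be an integer and let S ∈ ℂ[x,y,z,w] be a nonzero homogeneous polynomial of degree d ≤ 48p − 1 that vanishes to order at least 18p at every point of the F4 configuration. Then for every line ℓ ⊂ ℙ³ containing three points of the F4 configuration, S vanishes along ℓ to order at least 3p+1, i.e., S lies in I(ℓ)^{3p+1}, where I(ℓ) ⊂ ℂ[x,y,z,w] is the ideal generated by two independent linear forms cutting out ℓ. -/

import Mathlib

open MvPolynomial

/-- A polynomial `F` vanishes to order at least `m` at a point with representative
vector `v` if all partial derivatives of `F` of total order less than `m` vanish at `v`. -/
def vanishesToOrder (F : MvPolynomial (Fin 4) ℂ) (v : Fin 4 → ℂ) (m : ℕ) : Prop :=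
  ∀ l : List (Fin 4), l.length < m →
    eval v (l.foldl (fun G i => pderiv i G) F) = 0

/-- The 24 points of the F4 configuration, given by representative vectors. -/
def F4Pts : Fin 24 → (Fin 4 → ℂ) :=
  ![![1, 1, 0, 0], ![1, -1, 0, 0], ![1, 0, 1, 0], ![1, 0, -1, 0],
    ![1, 0, 0, 1], ![1, 0, 0, -1], ![0, 1, 1, 0], ![0, 1, -1, 0],
    ![0, 1, 0, 1], ![0, 1, 0, -1], ![0, 0, 1, 1], ![0, 0, 1, -1],
    ![1, 0, 0, 0], ![0, 1, 0, 0], ![0, 0, 1, 0], ![0, 0, 0, 1],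
    ![1, 1, 1, 1], ![1, 1, -1, -1], ![1, -1, 1, -1], ![1, -1, -1, 1],
    ![-1, 1, 1, 1], ![1, -1, 1, 1], ![1, 1, -1, 1], ![1, 1, 1, -1]]

/-- The translation `X ↦ X + v`. -/
noncomputable def f4Transl (v : Fin 4 → ℂ) :
    MvPolynomial (Fin 4) ℂ →ₐ[ℂ] MvPolynomial (Fin 4) ℂ :=
  aeval (fun r => X r + C (v r))

theorem f4_pderiv_transl (v : Fin 4 → ℂ) (i : Fin 4) (F : MvPolynomial (Fin 4) ℂ) :
    pderiv i (f4Transl v F) = f4Transl v (pderiv i F) := by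
  induction F using MvPolynomial.induction_on with
  | C a => simp [f4Transl]
  | add p q hp hq => simp [hp, hq]
  | mul_X p n h =>
    simp only [map_mul, Derivation.leibniz, smul_eq_mul, map_add, h]
    by_cases hn : n = i
    · subst hn; simp [f4Transl]
    · simp [f4Transl, pderiv_X_of_ne hn]

theorem f4_eval_transl (v : Fin 4 → ℂ) (F : MvPolynomial (Fin 4) ℂ) :
    coeff 0 (f4Transl v F) = eval v F := by
  rw [← constantCoeff_eq]
  induction F using MvPolynomial.induction_on with
  | C a => simp [f4Transl]
  | add p q hp hq => simp [hp, hq]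
  | mul_X p n h => simp [h]; simp [f4Transl]

theorem f4_coeff_transl (v : Fin 4 → ℂ) (m : ℕ) : ∀ F : MvPolynomial (Fin 4) ℂ,
    vanishesToOrder F v m → ∀ s : Fin 4 →₀ ℕ, s.degree < m → coeff s (f4Transl v F) = 0 := by
  induction m with
  | zero => intro F _ s hs; omega
  | succ m ih =>
    intro F hF s hs
    by_cases h0 : s = 0
    · subst h0
      rw [f4_eval_transl]
      exact hF [] (by simp)
    · obtain ⟨i, hi⟩ : ∃ i, s i ≠ 0 := by
        by_contra! h
        exact h0 (Finsupp.ext h)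
      have e : s - Finsupp.single i 1 + Finsupp.single i 1 = s :=
        Finsupp.sub_add_single_one_cancel hi
      have h1 : vanishesToOrder (pderiv i F) v m := by
        intro l hl
        exact hF (i :: l) (by simpa using hl)
      have h2 := ih _ h1 (s - Finsupp.single i 1) (by
        have := congrArg Finsupp.degree e
        rw [map_add, Finsupp.degree_single] at this
        omega)
      rw [← f4_pderiv_transl, coeff_pderiv, e] at h2
      rcases mul_eq_zero.mp h2 with h | h
      · exact h
      · exfalso
        exact Nat.cast_add_one_ne_zero _ h

/-- The ideal of an (affine) point. -/
noncomputable def f4Ideal (v : Fin 4 → ℂ) : Ideal (MvPolynomial (Fin 4) ℂ) :=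
  Ideal.span (Set.range fun r => X r - C (v r))

theorem f4_mem_ideal (v : Fin 4 → ℂ) (m : ℕ) (F : MvPolynomial (Fin 4) ℂ)
    (hF : vanishesToOrder F v m) : F ∈ f4Ideal v ^ m := by
  have h1 : f4Transl v F ∈ idealOfVars (Fin 4) ℂ ^ m := by
    rw [mem_pow_idealOfVars_iff']
    intro s hs
    exact f4_coeff_transl v m F hF s hs
  have h2 := Ideal.mem_map_of_mem (f4Transl (-v)) h1
  have h3 : f4Transl (-v) (f4Transl v F) = F := by
    have : (f4Transl (-v)).comp (f4Transl v) = AlgHom.id ℂ _ := by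
      ext i
      simp [f4Transl]
    exact DFunLike.congr_fun this F
  rw [h3, Ideal.map_pow] at h2
  refine Ideal.pow_right_mono ?_ m h2
  rw [idealOfVars, Ideal.map_span, Ideal.span_le]
  rintro _ ⟨_, ⟨r, rfl⟩, rfl⟩
  refine Ideal.subset_span ⟨r, ?_⟩
  simp [f4Transl, sub_eq_add_neg]

theorem f4_ideal_map {A : Type*} [CommRing A] [Algebra ℂ A]
    (f : MvPolynomial (Fin 4) ℂ →ₐ[ℂ] A) (v : Fin 4 → ℂ) (m : ℕ) (F : MvPolynomial (Fin 4) ℂ)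
    (hF : F ∈ f4Ideal v ^ m) (J : Ideal A)
    (hJ : ∀ r, f (X r) - algebraMap ℂ A (v r) ∈ J) : f F ∈ J ^ m := by
  have h2 := Ideal.mem_map_of_mem f hF
  rw [Ideal.map_pow] at h2
  refine Ideal.pow_right_mono ?_ m h2
  rw [f4Ideal, Ideal.map_span, Ideal.span_le]
  rintro _ ⟨_, ⟨r, rfl⟩, rfl⟩
  have := hJ r
  simpa [← MvPolynomial.algebraMap_eq] using this

theorem f4_ideal_scale (c : ℂ) (hc : c ≠ 0) (v : Fin 4 → ℂ) (m d : ℕ)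
    (F : MvPolynomial (Fin 4) ℂ) (hd : F.IsHomogeneous d)
    (hF : F ∈ f4Ideal v ^ m) : F ∈ f4Ideal (c • v) ^ m := by
  have h := f4_ideal_map (aeval (fun r => C c⁻¹ * X r) : _ →ₐ[ℂ] MvPolynomial (Fin 4) ℂ) v m F hF
    (f4Ideal (c • v)) (by
      intro r
      have : (X r - C ((c • v) r) : MvPolynomial (Fin 4) ℂ) ∈ f4Ideal (c • v) :=
        Ideal.subset_span ⟨r, rfl⟩
      have := Ideal.mul_mem_left _ (C c⁻¹) this
      convert this using 1
      simp only [aeval_X, algebraMap_eq, mul_sub, ← C_mul, Pi.smul_apply, smul_eq_mul]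
      rw [inv_mul_cancel_left₀ hc])
  have e : (aeval (fun r => C c⁻¹ * X r) : _ →ₐ[ℂ] MvPolynomial (Fin 4) ℂ) F = C (c⁻¹ ^ d) * F := by
    conv_rhs => rw [F.as_sum]
    conv_lhs => rw [F.as_sum]
    rw [map_sum, Finset.mul_sum]
    refine Finset.sum_congr rfl fun s hs => ?_
    have hds := hd.degree_eq_sum_deg_support hs
    rw [aeval_monomial, monomial_eq, algebraMap_eq]
    rw [hds, Finsupp.prod, Finsupp.prod]
    simp only [mul_pow, Finset.prod_mul_distrib, Finset.prod_pow_eq_pow_sum, C_pow]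
    ring
  rw [e] at h
  have h' := Ideal.mul_mem_left _ (C (c ^ d)) h
  rwa [← mul_assoc, ← C_mul, ← mul_pow, mul_inv_cancel₀ hc, one_pow, C_1, one_mul] at h'

/-- Coefficients of an element of `(a, y, z)^m`. -/
theorem f4_coeff_dvd {R : Type*} [CommRing R] (a : R) (m : ℕ) (F : MvPolynomial (Fin 2) R)
    (hF : F ∈ (Ideal.span (insert (C a) (Set.range X)) : Ideal (MvPolynomial (Fin 2) R)) ^ m) :
    ∀ s : Fin 2 →₀ ℕ, a ^ (m - s.degree) ∣ coeff s F := by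
  induction m generalizing F with
  | zero => intro s; simp
  | succ m ih =>
    rw [pow_succ'] at hF
    refine Submodule.mul_induction_on hF ?_ ?_
    · intro f hf g hg
      refine Submodule.span_induction (p := fun f _ => ∀ s : Fin 2 →₀ ℕ,
        a ^ (m + 1 - s.degree) ∣ coeff s (f * g)) ?_ ?_ ?_ ?_ hf
      · rintro _ (rfl | ⟨r, rfl⟩) s
        · rw [coeff_C_mul]
          calc a ^ (m + 1 - s.degree) ∣ a ^ ((m - s.degree) + 1) := pow_dvd_pow _ (by omega)
            _ = a * a ^ (m - s.degree) := pow_succ' _ _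
            _ ∣ _ := mul_dvd_mul_left _ (ih g hg s)
        · rw [mul_comm, coeff_mul_X']
          split_ifs with h
          · have e : s - Finsupp.single r 1 + Finsupp.single r 1 = s :=
              Finsupp.sub_add_single_one_cancel (by simpa using h)
            have e' := congrArg Finsupp.degree e
            rw [map_add, Finsupp.degree_single] at e'
            have := ih g hg (s - Finsupp.single r 1)
            refine (pow_dvd_pow _ ?_).trans this
            omega
          · exact dvd_zero _
      · intro s; simp
      · intro x y _ _ hx hy s
        rw [add_mul, coeff_add]
        exact dvd_add (hx s) (hy s)
      · intro c x _ hx s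
        rw [smul_eq_mul, mul_assoc, coeff_mul]
        refine Finset.dvd_sum fun q hq => ?_
        refine Dvd.dvd.mul_left ((pow_dvd_pow _ ?_).trans (hx q.2)) _
        rw [Finset.HasAntidiagonal.mem_antidiagonal] at hq
        have e' := congrArg Finsupp.degree hq
        rw [map_add] at e'
        omega
    · intro x y hx hy s
      rw [coeff_add]
      exact dvd_add (hx s) (hy s)

/-- Dehomogenization, `(X₀, X₁, X₂, X₃) ↦ (x, 1, y, z)`. -/
noncomputable def f4Dehom :
    MvPolynomial (Fin 4) ℂ →ₐ[ℂ] MvPolynomial (Fin 2) (Polynomial ℂ) :=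
  aeval ![C Polynomial.X, 1, X 0, X 1]

noncomputable def f4Tail (m : Fin 4 →₀ ℕ) : Fin 2 →₀ ℕ :=
  Finsupp.single 0 (m 2) + Finsupp.single 1 (m 3)

theorem f4_tail_degree (m : Fin 4 →₀ ℕ) : (f4Tail m).degree = m 2 + m 3 := by
  simp [f4Tail]

theorem f4_degree (m : Fin 4 →₀ ℕ) : m.degree = m 0 + m 1 + m 2 + m 3 := by
  rw [Finsupp.degree_eq_sum, Fin.sum_univ_four]

theorem f4_hom_degree (T : MvPolynomial (Fin 4) ℂ) (d : ℕ) (hT : T.IsHomogeneous d)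
    (m : Fin 4 →₀ ℕ) (hm : m ∈ T.support) : m 0 + m 1 + m 2 + m 3 = d := by
  rw [← f4_degree]
  by_contra h
  exact (mem_support_iff.mp hm) (hT.coeff_eq_zero h)

theorem f4_dehom_monomial (m : Fin 4 →₀ ℕ) (c : ℂ) :
    f4Dehom (monomial m c) = monomial (f4Tail m) (Polynomial.monomial (m 0) c) := by
  rw [f4Dehom, aeval_monomial, Finsupp.prod_fintype _ _ (by simp), Fin.prod_univ_four]
  have h1 : (algebraMap ℂ (MvPolynomial (Fin 2) (Polynomial ℂ))) c = C (Polynomial.C c) := rfl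
  rw [h1, f4Tail, ← Polynomial.C_mul_X_pow_eq_monomial, ← mul_one (Polynomial.C c * _)]
  have h2 : ∀ (s t : Fin 2 →₀ ℕ) (a : Polynomial ℂ), monomial (s + t) (a * 1) =
    monomial s a * (monomial t 1 : MvPolynomial (Fin 2) (Polynomial ℂ)) := fun s t a => by
      rw [monomial_mul]
  rw [h2, ← X_pow_eq_monomial, ← C_mul_X_pow_eq_monomial]
  simp only [Matrix.cons_val, map_mul, map_pow]
  ring

theorem f4_coeff_dehom (T : MvPolynomial (Fin 4) ℂ) (s : Fin 2 →₀ ℕ) :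
    coeff s (f4Dehom T) = ∑ m ∈ T.support,
      if f4Tail m = s then Polynomial.monomial (m 0) (coeff m T) else 0 := by
  conv_lhs => rw [T.as_sum]
  rw [map_sum, coeff_sum]
  refine Finset.sum_congr rfl fun m _ => ?_
  rw [f4_dehom_monomial, coeff_monomial]

theorem f4_dehom_natDegree (T : MvPolynomial (Fin 4) ℂ) (d : ℕ) (hT : T.IsHomogeneous d)
    (s : Fin 2 →₀ ℕ) : (coeff s (f4Dehom T)).natDegree ≤ d - s.degree := by
  rw [f4_coeff_dehom]
  refine Polynomial.natDegree_sum_le_of_forall_le _ _ fun m hm => ?_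
  split_ifs with h
  · refine (Polynomial.natDegree_monomial_le _).trans ?_
    have := f4_hom_degree T d hT m hm
    rw [← h, f4_tail_degree]
    omega
  · simp

theorem f4_dehom_coeff (T : MvPolynomial (Fin 4) ℂ) (d : ℕ) (hT : T.IsHomogeneous d)
    (m : Fin 4 →₀ ℕ) (hm : m ∈ T.support) :
    (coeff (f4Tail m) (f4Dehom T)).coeff (m 0) = coeff m T := by
  rw [f4_coeff_dehom, Polynomial.finsetSum_coeff, Finset.sum_eq_single m]
  · simp
  · intro n hn hne
    split_ifs with h
    · rw [Polynomial.coeff_monomial, if_neg]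
      intro h0
      apply hne
      have a1 := f4_hom_degree T d hT m hm
      have a2 := f4_hom_degree T d hT n hn
      have c2 : n 2 = m 2 := by simpa [f4Tail] using DFunLike.congr_fun h 0
      have c3 : n 3 = m 3 := by simpa [f4Tail] using DFunLike.congr_fun h 1
      ext i
      fin_cases i <;> simp <;> omega
    · simp
  · intro h; exact absurd hm h

/-- The Bezout step: a polynomial with three roots of multiplicity `k` and degree `< 3k`. -/
theorem f4_bezout (q : Polynomial ℂ) (k e : ℕ) (a b c : ℂ) (hab : a ≠ b) (hac : a ≠ c)
    (hbc : b ≠ c) (he : q.natDegree ≤ e) (hk : e < 3 * k)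
    (ha : (Polynomial.X - Polynomial.C a) ^ k ∣ q)
    (hb : (Polynomial.X - Polynomial.C b) ^ k ∣ q)
    (hc : (Polynomial.X - Polynomial.C c) ^ k ∣ q) : q = 0 := by
  have cop : ∀ x y : ℂ, x ≠ y → IsCoprime ((Polynomial.X - Polynomial.C x) ^ k)
      ((Polynomial.X - Polynomial.C y) ^ k) := fun x y h =>
    (Polynomial.isCoprime_X_sub_C_of_isUnit_sub (sub_ne_zero.mpr h).isUnit).pow
  have h1 := (cop a b hab).mul_dvd ha hb
  have h2 := ((cop a c hac).mul_left (cop b c hbc)).mul_dvd h1 hc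
  by_contra hq
  have h3 := Polynomial.natDegree_le_of_dvd h2 hq
  rw [← mul_pow, ← mul_pow, Polynomial.natDegree_pow] at h3
  have h4 : ((Polynomial.X - Polynomial.C a) * (Polynomial.X - Polynomial.C b) *
      (Polynomial.X - Polynomial.C c)).natDegree = 3 := by
    rw [Polynomial.natDegree_mul (mul_ne_zero (Polynomial.X_sub_C_ne_zero _)
      (Polynomial.X_sub_C_ne_zero _)) (Polynomial.X_sub_C_ne_zero _),
      Polynomial.natDegree_mul (Polynomial.X_sub_C_ne_zero _) (Polynomial.X_sub_C_ne_zero _)]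
    simp
  rw [h4] at h3
  omega

/-- Linear change of coordinates attached to four vectors. -/
noncomputable def f4Change (v : Fin 4 → Fin 4 → ℂ) :
    MvPolynomial (Fin 4) ℂ →ₐ[ℂ] MvPolynomial (Fin 4) ℂ :=
  aeval (fun r => ∑ c, C (v c r) * X c)

theorem f4_coord (p d : ℕ) (hd : d ≤ 48 * p - 1) (hp : 1 ≤ p) (S : MvPolynomial (Fin 4) ℂ)
    (hS : S.IsHomogeneous d) (v : Fin 4 → Fin 4 → ℂ)
    (h0 : S ∈ f4Ideal (v 1) ^ (18 * p))
    (h1 : S ∈ f4Ideal (v 1 + v 0) ^ (18 * p))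
    (h2 : S ∈ f4Ideal (v 1 + (2⁻¹ : ℂ) • v 0) ^ (18 * p)) :
    ∀ m ∈ (f4Change v S).support, 3 * p + 1 ≤ m 2 + m 3 := by
  intro m hm
  by_contra! hlt
  have hT : (f4Change v S).IsHomogeneous d := by
    have := hS.aeval (fun r => ∑ c, C (v c r) * X c : Fin 4 → MvPolynomial (Fin 4) ℂ) (n := 1)
      (fun r => IsHomogeneous.sum _ _ _ fun c _ => isHomogeneous_C_mul_X _ _)
    rwa [one_mul] at this
  have key : ∀ g : ℂ, S ∈ f4Ideal (v 1 + g • v 0) ^ (18 * p) →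
      (Polynomial.X - Polynomial.C g) ^ (18 * p - (m 2 + m 3)) ∣
        coeff (f4Tail m) (f4Dehom (f4Change v S)) := by
    intro g hg
    rw [← f4_tail_degree]
    apply f4_coeff_dvd
    refine f4_ideal_map (f4Dehom.comp (f4Change v)) _ _ S hg _ fun r => ?_
    set J : Ideal (MvPolynomial (Fin 2) (Polynomial ℂ)) :=
      Ideal.span (insert (C (Polynomial.X - Polynomial.C g)) (Set.range X)) with hJ
    have hx : (C (Polynomial.X - Polynomial.C g) : MvPolynomial (Fin 2) (Polynomial ℂ)) ∈ J :=
      Ideal.subset_span (Set.mem_insert _ _)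
    have hy : ∀ i : Fin 2, (X i : MvPolynomial (Fin 2) (Polynomial ℂ)) ∈ J := fun i =>
      Ideal.subset_span (Set.mem_insert_of_mem _ ⟨i, rfl⟩)
    have ac : ∀ z : ℂ, (algebraMap ℂ (MvPolynomial (Fin 2) (Polynomial ℂ))) z
      = C (Polynomial.C z) := fun _ => rfl
    have hC : ∀ z : ℂ, f4Dehom (C z) = C (Polynomial.C z) := fun z => by
      rw [← ac, ← f4Dehom.commutes, algebraMap_eq]
    have hX : ∀ i, f4Dehom (X i) =
      (![C Polynomial.X, 1, X 0, X 1] : Fin 4 → MvPolynomial (Fin 2) (Polynomial ℂ)) i :=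
      fun i => by rw [f4Dehom, aeval_X]
    have e : (f4Dehom.comp (f4Change v)) (X r) -
        algebraMap ℂ (MvPolynomial (Fin 2) (Polynomial ℂ)) ((v 1 + g • v 0) r) =
        C (Polynomial.C (v 0 r)) * C (Polynomial.X - Polynomial.C g) +
        C (Polynomial.C (v 2 r)) * X 0 + C (Polynomial.C (v 3 r)) * X 1 := by
      rw [AlgHom.comp_apply, f4Change, aeval_X, Fin.sum_univ_four, ac]
      simp only [map_add, map_mul, hC, hX, map_sub, Pi.add_apply, Pi.smul_apply, smul_eq_mul,
        Matrix.cons_val]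
      ring
    rw [e]
    exact J.add_mem (J.add_mem (J.mul_mem_left _ hx) (J.mul_mem_left _ (hy 0)))
      (J.mul_mem_left _ (hy 1))
  have k0 := key 0 (by simpa using h0)
  have k1 := key 1 (by simpa using h1)
  have k2 := key 2⁻¹ h2
  have hz := f4_bezout _ _ (d - (m 2 + m 3)) 0 1 2⁻¹ (by norm_num) (by norm_num) (by norm_num)
    (by rw [← f4_tail_degree]; exact f4_dehom_natDegree _ d hT _) (by omega) k0 k1 k2
  have := f4_dehom_coeff _ d hT m hm
  rw [hz, Polynomial.coeff_zero] at this
  exact (mem_support_iff.mp hm) this.symm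

theorem f4_mem_of_coord (S : MvPolynomial (Fin 4) ℂ) (v : Fin 4 → Fin 4 → ℂ)
    (M : Fin 4 → MvPolynomial (Fin 4) ℂ) (hM : ∀ r, ∑ c, C (v c r) * M c = X r) (k : ℕ)
    (h : ∀ m ∈ (f4Change v S).support, k ≤ m 2 + m 3) :
    S ∈ (Ideal.span {M 2, M 3} : Ideal (MvPolynomial (Fin 4) ℂ)) ^ k := by
  have e : aeval M (f4Change v S) = S := by
    have : (aeval M).comp (f4Change v) = AlgHom.id ℂ _ := by
      ext i
      simp only [f4Change, AlgHom.comp_apply, aeval_X, map_sum, map_mul, AlgHom.id_apply]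
      simp only [← hM i, aeval_C, algebraMap_eq]
    exact DFunLike.congr_fun this S
  rw [← e, (f4Change v S).as_sum, map_sum]
  refine Ideal.sum_mem _ fun m hm => ?_
  rw [aeval_monomial, Finsupp.prod_fintype _ _ (by simp), Fin.prod_univ_four, mul_assoc (_ * _)]
  refine Ideal.mul_mem_left _ _ (Ideal.mul_mem_left _ _ ?_)
  refine Ideal.pow_le_pow_right (h m hm) ?_
  rw [pow_add]
  exact Ideal.mul_mem_mul (Ideal.pow_mem_pow (Ideal.subset_span (by simp)) _)
    (Ideal.pow_mem_pow (Ideal.subset_span (by simp)) _)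

theorem f4_linear_form (L : MvPolynomial (Fin 4) ℂ) (hL : L.IsHomogeneous 1) :
    ∃ a : Fin 4 → ℂ, L = ∑ r, C (a r) * X r := by
  have : L ∈ homogeneousSubmodule (Fin 4) ℂ 1 := hL
  rw [homogeneousSubmodule_one_eq_span_X, Submodule.mem_span_range_iff_exists_fun] at this
  obtain ⟨a, ha⟩ := this
  exact ⟨a, by rw [← ha]; simp [smul_eq_C_mul]⟩

theorem f4_basis (L₁ L₂ : MvPolynomial (Fin 4) ℂ) (hL₁ : L₁.IsHomogeneous 1)
    (hL₂ : L₂.IsHomogeneous 1) (hL : LinearIndependent ℂ ![L₁, L₂]) (u w : Fin 4 → ℂ)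
    (huw : LinearIndependent ℂ ![u, w]) (hu₁ : eval u L₁ = 0) (hu₂ : eval u L₂ = 0)
    (hw₁ : eval w L₁ = 0) (hw₂ : eval w L₂ = 0) :
    ∃ v M : Fin 4 → _, v 0 = u ∧ v 1 = w ∧ M 2 = L₁ ∧ M 3 = L₂ ∧
      ∀ r, ∑ c, C (v c r) * M c = (X r : MvPolynomial (Fin 4) ℂ) := by
  obtain ⟨a, rfl⟩ := f4_linear_form L₁ hL₁
  obtain ⟨b, rfl⟩ := f4_linear_form L₂ hL₂
  have hab : LinearIndependent ℂ ![a, b] := by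
    rw [LinearIndependent.pair_iff] at hL ⊢
    intro s t hst
    refine hL s t ?_
    simp only [smul_eq_C_mul, Finset.mul_sum, ← Finset.sum_add_distrib]
    refine Finset.sum_eq_zero fun r _ => ?_
    have := congrFun hst r
    simp only [Pi.add_apply, Pi.smul_apply, smul_eq_mul, Pi.zero_apply] at this
    rw [← mul_assoc, ← mul_assoc, ← add_mul, ← C_mul, ← C_mul, ← C_add, this, C_0, zero_mul]
  let A : Matrix (Fin 2) (Fin 4) ℂ := ![a, b]
  have hrank : A.rank = 2 := by
    have := LinearIndependent.rank_matrix (M := A) hab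
    simpa using this
  have hrange : LinearMap.range A.mulVecLin = ⊤ := by
    apply Submodule.eq_top_of_finrank_eq
    rw [← Matrix.rank, hrank]
    simp
  have hker : Module.finrank ℂ (LinearMap.ker A.mulVecLin) = 2 := by
    have := LinearMap.finrank_range_add_finrank_ker A.mulVecLin
    rw [hrange, finrank_top] at this
    simp at this
    omega
  have hA : ∀ x, A.mulVecLin x = ![eval x (∑ r, C (a r) * X r), eval x (∑ r, C (b r) * X r)] := by
    intro x
    ext i
    rw [Matrix.mulVecLin_apply, Matrix.mulVec, dotProduct]
    fin_cases i <;> simp [A]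
  have hspan : Submodule.span ℂ (Set.range ![u, w]) = LinearMap.ker A.mulVecLin := by
    apply Submodule.eq_of_le_of_finrank_le
    · rw [Submodule.span_le]
      rintro _ ⟨i, rfl⟩
      rw [SetLike.mem_coe, LinearMap.mem_ker, hA]
      fin_cases i
      · simp only [Fin.zero_eta, Matrix.cons_val_zero, hu₁, hu₂]; simp
      · simp only [Fin.mk_one, Matrix.cons_val_one, Matrix.cons_val_zero, hw₁, hw₂]; simp
    · rw [hker, finrank_span_eq_card huw]; simp
  obtain ⟨v2, hv2⟩ := LinearMap.range_eq_top.mp hrange ![1, 0]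
  obtain ⟨v3, hv3⟩ := LinearMap.range_eq_top.mp hrange ![0, 1]
  have hdec : ∀ r : Fin 4, ∃ s t : ℂ,
      s • u + t • w = Pi.single r 1 - a r • v2 - b r • v3 := by
    intro r
    have : (Pi.single r 1 - a r • v2 - b r • v3 : Fin 4 → ℂ) ∈ LinearMap.ker A.mulVecLin := by
      rw [LinearMap.mem_ker, map_sub, map_sub, map_smul, map_smul, hv2, hv3, hA]
      ext i
      fin_cases i <;> simp [Pi.single_apply]
    rw [← hspan] at this
    rw [Matrix.range_cons, Matrix.range_cons, Matrix.range_empty, Set.union_empty,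
      Set.singleton_union] at this
    exact Submodule.mem_span_pair.mp this
  choose s t hst using hdec
  refine ⟨![u, w, v2, v3], ![∑ r, C (s r) * X r, ∑ r, C (t r) * X r, ∑ r, C (a r) * X r,
    ∑ r, C (b r) * X r], rfl, rfl, rfl, rfl, fun q => ?_⟩
  rw [Fin.sum_univ_four]
  simp only [Matrix.cons_val, Finset.mul_sum, ← Finset.sum_add_distrib]
  rw [Finset.sum_eq_single q]
  · have := congrFun (hst q) q
    simp only [Pi.add_apply, Pi.sub_apply, Pi.smul_apply, smul_eq_mul, Pi.single_eq_same] at this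
    have h1 : u q * s q + w q * t q + v2 q * a q + v3 q * b q = 1 := by linear_combination this
    simp only [← mul_assoc, ← add_mul, ← C_mul, ← C_add, h1, C_1, one_mul]
  · intro r _ hr
    have := congrFun (hst r) q
    simp only [Pi.add_apply, Pi.sub_apply, Pi.smul_apply, smul_eq_mul,
      Pi.single_eq_of_ne hr.symm] at this
    have h1 : u q * s r + w q * t r + v2 q * a r + v3 q * b r = 0 := by linear_combination this
    simp only [← mul_assoc, ← add_mul, ← C_mul, ← C_add, h1, C_0, zero_mul]
  · simp

/-- Integral coordinates of the configuration. -/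
def f4PtsZ : Fin 24 → (Fin 4 → ℤ) :=
  ![![1, 1, 0, 0], ![1, -1, 0, 0], ![1, 0, 1, 0], ![1, 0, -1, 0],
    ![1, 0, 0, 1], ![1, 0, 0, -1], ![0, 1, 1, 0], ![0, 1, -1, 0],
    ![0, 1, 0, 1], ![0, 1, 0, -1], ![0, 0, 1, 1], ![0, 0, 1, -1],
    ![1, 0, 0, 0], ![0, 1, 0, 0], ![0, 0, 1, 0], ![0, 0, 0, 1],
    ![1, 1, 1, 1], ![1, 1, -1, -1], ![1, -1, 1, -1], ![1, -1, -1, 1],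
    ![-1, 1, 1, 1], ![1, -1, 1, 1], ![1, 1, -1, 1], ![1, 1, 1, -1]]

theorem f4_cast (n : Fin 24) (r : Fin 4) : F4Pts n r = (f4PtsZ n r : ℂ) := by
  fin_cases n <;> fin_cases r <;> simp [F4Pts, f4PtsZ]

set_option maxRecDepth 100000 in
theorem f4_minor : ∀ i j : Fin 24, i ≠ j → ∃ r s : Fin 4,
    f4PtsZ i r * f4PtsZ j s ≠ f4PtsZ i s * f4PtsZ j r := by
  decide

theorem f4_indep (i j : Fin 24) (h : i ≠ j) : LinearIndependent ℂ ![F4Pts i, F4Pts j] := by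
  obtain ⟨r, s, hrs⟩ := f4_minor i j h
  rw [LinearIndependent.pair_iff]
  intro a b hab
  have hr := congrFun hab r
  have hs := congrFun hab s
  simp only [Pi.add_apply, Pi.smul_apply, smul_eq_mul, Pi.zero_apply] at hr hs
  have hne : F4Pts i r * F4Pts j s - F4Pts i s * F4Pts j r ≠ 0 := by
    rw [sub_ne_zero]
    simp only [f4_cast]
    exact_mod_cast hrs
  constructor
  · refine (mul_eq_zero.mp (?_ : a * (F4Pts i r * F4Pts j s - F4Pts i s * F4Pts j r) = 0)).resolve_right hne
    linear_combination F4Pts j s * hr - F4Pts j r * hs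
  · refine (mul_eq_zero.mp (?_ : b * (F4Pts i r * F4Pts j s - F4Pts i s * F4Pts j r) = 0)).resolve_right hne
    linear_combination F4Pts i r * hs - F4Pts i s * hr

/-- If `S` is a nonzero homogeneous polynomial of degree `d ≤ 48p - 1` vanishing to order
at least `18p` at all points of the F4 configuration, then for every line containing three
points of the configuration (cut out by two independent linear forms `L₁, L₂`), `S` lies
in the `(3p+1)`-st power of the ideal `(L₁, L₂)` of the line. -/
theorem F4_vanishing_on_three_point_lines (p : ℕ) (hp : 1 ≤ p)
    (S : MvPolynomial (Fin 4) ℂ) (d : ℕ) (hS : S ≠ 0) (hhom : S.IsHomogeneous d)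
    (hd : d ≤ 48 * p - 1)
    (hvan : ∀ n : Fin 24, vanishesToOrder S (F4Pts n) (18 * p)) :
    ∀ i j k : Fin 24, i ≠ j → j ≠ k → i ≠ k →
      Module.finrank ℂ
        (Submodule.span ℂ ({F4Pts i, F4Pts j, F4Pts k} : Set (Fin 4 → ℂ))) ≤ 2 →
      ∀ L₁ L₂ : MvPolynomial (Fin 4) ℂ, L₁.IsHomogeneous 1 → L₂.IsHomogeneous 1 →
        LinearIndependent ℂ ![L₁, L₂] →
        (∀ n ∈ ({i, j, k} : Set (Fin 24)), eval (F4Pts n) L₁ = 0 ∧ eval (F4Pts n) L₂ = 0) →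
        S ∈ (Ideal.span {L₁, L₂} : Ideal (MvPolynomial (Fin 4) ℂ)) ^ (3 * p + 1) := by
  intro i j k hij hjk hik hrank L₁ L₂ hL₁ hL₂ hL hv
  have hiv := hv i (by simp)
  have hjv := hv j (by simp)
  have hI := f4_indep i j hij
  have hspan : Submodule.span ℂ (Set.range ![F4Pts i, F4Pts j]) =
      Submodule.span ℂ ({F4Pts i, F4Pts j, F4Pts k} : Set (Fin 4 → ℂ)) := by
    apply Submodule.eq_of_le_of_finrank_le
    · apply Submodule.span_mono
      rintro _ ⟨q, rfl⟩
      fin_cases q <;> simp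
    · rw [finrank_span_eq_card hI]
      simpa using hrank
  have hk : F4Pts k ∈ Submodule.span ℂ (Set.range ![F4Pts i, F4Pts j]) := by
    rw [hspan]
    exact Submodule.subset_span (by simp)
  rw [Matrix.range_cons, Matrix.range_cons, Matrix.range_empty, Set.union_empty,
    Set.singleton_union] at hk
  obtain ⟨α, β, hk⟩ := Submodule.mem_span_pair.mp hk
  have hα : α ≠ 0 := by
    rintro rfl
    have := (LinearIndependent.pair_iff.mp (f4_indep j k hjk)) β (-1) (by rw [← hk]; simp)
    simp at this
  have hβ : β ≠ 0 := by
    rintro rfl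
    have := (LinearIndependent.pair_iff.mp (f4_indep i k hik)) α (-1) (by rw [← hk]; simp)
    simp at this
  set u : Fin 4 → ℂ := (2 * α) • F4Pts i with hu
  set w : Fin 4 → ℂ := (2 * β) • F4Pts j with hw
  have mem : ∀ n, S ∈ f4Ideal (F4Pts n) ^ (18 * p) := fun n => f4_mem_ideal _ _ _ (hvan n)
  have memu : S ∈ f4Ideal u ^ (18 * p) :=
    f4_ideal_scale _ (mul_ne_zero two_ne_zero hα) _ _ d S hhom (mem i)
  have memw : S ∈ f4Ideal w ^ (18 * p) :=
    f4_ideal_scale _ (mul_ne_zero two_ne_zero hβ) _ _ d S hhom (mem j)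
  have hlin : ∀ L : MvPolynomial (Fin 4) ℂ, L.IsHomogeneous 1 → eval (F4Pts i) L = 0 →
      eval (F4Pts j) L = 0 → ∀ s t : ℂ, eval (s • F4Pts i + t • F4Pts j) L = 0 := by
    intro L hL hi hj s t
    obtain ⟨a, rfl⟩ := f4_linear_form L hL
    simp only [map_sum, map_mul, eval_C, eval_X, Pi.add_apply, Pi.smul_apply, smul_eq_mul]
      at hi hj ⊢
    calc _ = s * ∑ r, a r * F4Pts i r + t * ∑ r, a r * F4Pts j r := by
          rw [Finset.mul_sum, Finset.mul_sum, ← Finset.sum_add_distrib]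
          exact Finset.sum_congr rfl fun r _ => by ring
      _ = 0 := by rw [hi, hj]; ring
  have ewu : w - u = (-(2 * α)) • F4Pts i + (2 * β) • F4Pts j := by
    rw [hu, hw, neg_smul]; abel
  have eu : u = (2 * α) • F4Pts i + (0 : ℂ) • F4Pts j := by
    rw [hu, zero_smul, add_zero]
  have hind : LinearIndependent ℂ ![w - u, u] := by
    rw [LinearIndependent.pair_iff] at hI ⊢
    intro s t hst
    have := hI (-(2 * α) * s + 2 * α * t) (2 * β * s) (by
      rw [← hst, ewu, hu]
      module)
    have hs : s = 0 := by simpa [hβ] using this.2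
    have ht := this.1
    rw [hs] at ht
    exact ⟨hs, by simpa [hα] using ht⟩
  obtain ⟨v, M, hv0, hv1, hM2, hM3, hM⟩ := f4_basis L₁ L₂ hL₁ hL₂ hL (w - u) u hind
    (by rw [ewu]; exact hlin _ hL₁ hiv.1 hjv.1 _ _) (by rw [ewu]; exact hlin _ hL₂ hiv.2 hjv.2 _ _)
    (by rw [eu]; exact hlin _ hL₁ hiv.1 hjv.1 _ _) (by rw [eu]; exact hlin _ hL₂ hiv.2 hjv.2 _ _)
  rw [← hM2, ← hM3]
  refine f4_mem_of_coord S v M hM _ (f4_coord p d hd hp S hhom v ?_ ?_ ?_)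
  · rwa [hv1]
  · rwa [hv0, hv1, add_sub_cancel]
  · have : v 1 + (2⁻¹ : ℂ) • v 0 = F4Pts k := by
      rw [hv0, hv1, ← hk, hu, hw]
      module
    rw [this]
    exact mem k
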